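/- Let h : B_R ⊆ ℝ^m → ℝ be a convex function. Then the set of points x ∈ B_R at which h is twice differentiable in the Alexandrov sense (h admits a second-order Taylor expansion at x) has full Lebesgue measure in B_R. -/

import Mathlib

open Real Filter Asymptotics RealInnerProductSpace MeasureTheory

/-- `f` is twice differentiable at `x` in the Alexandrov sense, with gradient `g` and Hessian
`A`: `f(y) = f(x) + ⟪g, y−x⟫ + ½⟪A(y−x), y−x⟫ + o(|y−x|²)`. -/
def Alexandrov2 {m : ℕ} (f : EuclideanSpace ℝ (Fin m) → ℝ) (x g : EuclideanSpace ℝ (Fin m))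
    (A : EuclideanSpace ℝ (Fin m) →L[ℝ] EuclideanSpace ℝ (Fin m)) : Prop :=
  (fun y => f y - f x - ⟪g, y - x⟫ - (1 / 2) * ⟪A (y - x), y - x⟫)
    =o[nhds x] fun y => ‖y - x‖ ^ 2

section AlexandrovAux

variable {E : Type*} [NormedAddCommGroup E] [InnerProductSpace ℝ E]

/-- A continuous convex function on an open set has a subgradient at every point. -/
theorem ConvexOn.exists_subgradient [CompleteSpace E] {U : Set E} {f : E → ℝ} (hU : IsOpen U)
    (hf : ConvexOn ℝ U f) (hc : ContinuousOn f U) {x : E} (hx : x ∈ U) :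
    ∃ p : E, ∀ y ∈ U, f x + ⟪p, y - x⟫ ≤ f y := by
  have hopen : IsOpen {q : E × ℝ | q.1 ∈ U ∧ f q.1 < q.2} := by
    have hV : IsOpen (U ×ˢ (Set.univ : Set ℝ)) := hU.prod isOpen_univ
    have hg : ContinuousOn (fun q : E × ℝ => q.2 - f q.1) (U ×ˢ (Set.univ : Set ℝ)) :=
      continuousOn_snd.sub (hc.comp continuousOn_fst fun q hq => hq.1)
    convert hg.isOpen_inter_preimage hV (isOpen_Ioi (a := (0 : ℝ))) using 1
    ext q
    simp
  obtain ⟨L, hL⟩ := geometric_hahn_banach_open_point (x := (x, f x)) hf.convex_strict_epigraph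
    hopen (by simp)
  have hsplit : ∀ (y : E) (t : ℝ), L (y, t) = L (y, 0) + t * L (0, 1) := by
    intro y t
    rw [← smul_eq_mul, ← map_smul, ← map_add]
    simp
  set α := L (0, 1) with hα
  have hneg : α < 0 := by
    have := hL (x, f x + 1) ⟨hx, by simp⟩
    rw [hsplit, hsplit x (f x)] at this
    linarith
  have hle : ∀ y ∈ U, L (y, 0) + f y * α ≤ L (x, 0) + f x * α := by
    intro y hy
    refine le_of_forall_pos_le_add fun ε hε => ?_
    have := hL (y, f y + ε / (-α)) ⟨hy, by simpa using div_pos hε (neg_pos.2 hneg)⟩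
    rw [hsplit, hsplit x (f x)] at this
    have h2 : ε / (-α) * α = -ε := by
      rw [div_neg, neg_mul, div_mul_cancel₀ _ hneg.ne]
    linarith
  let l : StrongDual ℝ E := (-α)⁻¹ • L.comp (ContinuousLinearMap.inl ℝ E ℝ)
  refine ⟨(InnerProductSpace.toDual ℝ E).symm l, fun y hy => ?_⟩
  rw [InnerProductSpace.toDual_symm_apply]
  have h1 : l (y - x) = (-α)⁻¹ * (L (y, 0) - L (x, 0)) := by
    simp [l, ← map_sub]
  have h2 := hle y hy
  rw [h1]
  have h3 : (-α)⁻¹ * (L (y, 0) - L (x, 0)) ≤ f y - f x := by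
    rw [inv_mul_le_iff₀ (neg_pos.2 hneg)]
    linarith
  linarith

/-- The proximal point of a convex function `h` on a compact convex set `K`, together with the
variational inequality characterizing it. -/
theorem ConvexOn.exists_prox {K : Set E} {h : E → ℝ} (hK : IsCompact K) (hne : K.Nonempty)
    (hconv : ConvexOn ℝ K h) (hc : ContinuousOn h K) (z : E) :
    ∃ p ∈ K, ∀ y ∈ K, h p + ⟪z - p, y - p⟫ ≤ h y := by
  obtain ⟨p, hp, hmin⟩ := hK.exists_isMinOn hne
    (f := fun y => h y + 1 / 2 * ‖y - z‖ ^ 2) (by fun_prop)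
  refine ⟨p, hp, fun y hy => ?_⟩
  have key : ∀ t : ℝ, 0 < t → t ≤ 1 →
      h p + ⟪z - p, y - p⟫ - h y ≤ t * (1 / 2 * ‖y - p‖ ^ 2) := by
    intro t ht ht1
    have hmem : (1 - t) • p + t • y ∈ K :=
      hconv.1 hp hy (by linarith) ht.le (by ring)
    have h1 := hmin hmem
    have h2 : h ((1 - t) • p + t • y) ≤ (1 - t) • h p + t • h y :=
      hconv.2 hp hy (by linarith) ht.le (by ring)
    simp only [Set.mem_ofPred_eq, smul_eq_mul] at h1 h2
    have h3 : (1 - t) • p + t • y - z = (p - z) + t • (y - p) := by module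
    rw [h3, norm_add_sq_real, norm_smul, inner_smul_right, mul_pow, Real.norm_eq_abs,
      sq_abs] at h1
    have h4 : ⟪p - z, y - p⟫ = -⟪z - p, y - p⟫ := by rw [← inner_neg_left]; simp
    rw [h4] at h1
    refine le_of_mul_le_mul_left ?_ ht
    nlinarith
  refine le_of_forall_pos_le_add fun ε hε => ?_
  set B := 1 / 2 * ‖y - p‖ ^ 2
  have hB : 0 ≤ B := by positivity
  have := key (min 1 (ε / (B + 1))) (by positivity) (min_le_left _ _)
  have h2 : min 1 (ε / (B + 1)) * B ≤ ε := by
    calc min 1 (ε / (B + 1)) * B ≤ ε / (B + 1) * (B + 1) := by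
          gcongr
          · exact min_le_right _ _
          · linarith
      _ = ε := by field_simp
  linarith

section Prox

variable {h : E → ℝ} {J : E → E}

/-- Points satisfying the proximal variational inequality depend firmly nonexpansively on
the base point. -/
theorem norm_sub_sq_le_inner_of_prox {z w p q : E}
    (h1 : h p + ⟪z - p, q - p⟫ ≤ h q) (h2 : h q + ⟪w - q, p - q⟫ ≤ h p) :
    ‖p - q‖ ^ 2 ≤ ⟪z - w, p - q⟫ := by
  rw [← real_inner_self_eq_norm_sq]
  simp only [inner_sub_left, inner_sub_right] at *
  linarith

theorem lipschitzWith_of_firmly_nonexpansive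
    (hJ : ∀ z w, ‖J z - J w‖ ^ 2 ≤ ⟪z - w, J z - J w⟫) : LipschitzWith 1 J := by
  refine LipschitzWith.of_dist_le_mul fun z w => ?_
  rw [dist_eq_norm, dist_eq_norm, NNReal.coe_one, one_mul]
  have h1 := (hJ z w).trans (real_inner_le_norm _ _)
  by_contra! hlt
  nlinarith [norm_nonneg (z - w)]

/-- A function with a Lipschitz selection of subgradients is differentiable. -/
theorem hasFDerivAt_of_lipschitz_subgradient {ψ : E → ℝ} (hJ : LipschitzWith 1 J)
    (hψ : ∀ z w, ψ z + ⟪J z, w - z⟫ ≤ ψ w) (z : E) :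
    HasFDerivAt ψ (innerSL ℝ (J z)) z := by
  rw [hasFDerivAt_iff_isLittleO]
  have hO : (fun w => ψ w - ψ z - innerSL ℝ (J z) (w - z)) =O[nhds z] fun w => ‖w - z‖ ^ 2 := by
    refine IsBigO.of_bound 1 (Eventually.of_forall fun w => ?_)
    rw [innerSL_apply_apply, Real.norm_eq_abs, norm_pow, norm_norm, one_mul, abs_le]
    have h1 := hψ z w
    have h2 := hψ w z
    have h3 : ⟪J w - J z, w - z⟫ ≤ ‖w - z‖ ^ 2 := by
      refine (real_inner_le_norm _ _).trans ?_
      have := hJ.dist_le_mul w z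
      rw [dist_eq_norm, dist_eq_norm, NNReal.coe_one, one_mul] at this
      nlinarith [norm_nonneg (w - z)]
    have h4 : ⟪J w, z - w⟫ = -⟪J w, w - z⟫ := by rw [← inner_neg_right]; simp
    rw [inner_sub_left] at h3
    constructor <;> nlinarith [sq_nonneg ‖w - z‖]
  refine hO.trans_isLittleO ?_
  exact isLittleO_pow_sub_sub z one_lt_two

theorem convexOn_of_subgradient {ψ : E → ℝ} (hψ : ∀ z w, ψ z + ⟪J z, w - z⟫ ≤ ψ w) :
    ConvexOn ℝ Set.univ ψ := by
  refine ⟨convex_univ, fun x _ y _ a b ha hb hab => ?_⟩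
  have h1 := mul_le_mul_of_nonneg_left (hψ (a • x + b • y) x) ha
  have h2 := mul_le_mul_of_nonneg_left (hψ (a • x + b • y) y) hb
  have h3 : a * ⟪J (a • x + b • y), x - (a • x + b • y)⟫ +
      b * ⟪J (a • x + b • y), y - (a • x + b • y)⟫ = 0 := by
    rw [← inner_smul_right, ← inner_smul_right, ← inner_add_right]
    have : a • (x - (a • x + b • y)) + b • (y - (a • x + b • y)) = 0 := by
      obtain rfl : b = 1 - a := by linarith
      module
    rw [this, inner_zero_right]
  simp only [smul_eq_mul]
  have h4 : a * ψ (a • x + b • y) + b * ψ (a • x + b • y) = ψ (a • x + b • y) := by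
    rw [← add_mul, hab, one_mul]
  linarith

end Prox

/-- If the gradient `J` of `ψ` is differentiable at a point, its derivative is symmetric. -/
theorem inner_symm_of_hasFDerivAt_gradient {ψ : E → ℝ} {J : E → E} {D : E →L[ℝ] E} {z₀ : E}
    (hψ : ∀ z, HasFDerivAt ψ (innerSL ℝ (J z)) z) (hJ : HasFDerivAt J D z₀) (v w : E) :
    ⟪D v, w⟫ = ⟪v, D w⟫ := by
  have := second_derivative_symmetric hψ ((innerSL ℝ (E := E)).hasFDerivAt.comp z₀ hJ) v w
  rw [real_inner_comm (D w) v]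
  exact this

/-- Second-order Taylor expansion of a function whose gradient is differentiable at a point. -/
theorem isLittleO_taylor_two_of_hasFDerivAt_gradient {ψ : E → ℝ} {J : E → E} {D : E →L[ℝ] E}
    {z₀ : E} (hψ : ∀ z, HasFDerivAt ψ (innerSL ℝ (J z)) z) (hJ : HasFDerivAt J D z₀) :
    (fun w => ψ (z₀ + w) - ψ z₀ - ⟪J z₀, w⟫ - 1 / 2 * ⟪D w, w⟫)
      =o[nhds 0] fun w => ‖w‖ ^ 2 := by
  have hsym := inner_symm_of_hasFDerivAt_gradient hψ hJ
  have hq : ∀ w, HasFDerivAt (fun w => ψ (z₀ + w) - ψ z₀ - ⟪J z₀, w⟫ - 1 / 2 * ⟪D w, w⟫)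
      (innerSL ℝ (J (z₀ + w) - J z₀ - D w)) w := by
    intro w
    have h1 : HasFDerivAt (fun w => ψ (z₀ + w)) (innerSL ℝ (J (z₀ + w))) w :=
      (hψ (z₀ + w)).comp w ((hasFDerivAt_id w).const_add z₀)
    have h2 : HasFDerivAt (fun w => ⟪J z₀, w⟫) (innerSL ℝ (J z₀)) w :=
      (innerSL ℝ (J z₀)).hasFDerivAt
    have h3 := (D.hasFDerivAt (x := w)).inner ℝ (hasFDerivAt_id w)
    refine (((h1.sub_const (ψ z₀)).sub h2).sub (h3.const_mul (1 / 2))).congr_fderiv ?_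
    ext v
    simp [fderivInnerCLM_apply]
    rw [hsym v w, real_inner_comm (D w) v]
    ring
  rw [isLittleO_iff]
  intro ε hε
  have hJ' := (hasFDerivAt_iff_isLittleO_nhds_zero.1 hJ).def hε
  obtain ⟨δ, hδ, hb⟩ := Metric.eventually_nhds_iff_ball.1 hJ'
  filter_upwards [Metric.ball_mem_nhds (0 : E) hδ] with w hw
  have hmv := (convex_closedBall (0 : E) ‖w‖).norm_image_sub_le_of_norm_hasFDerivWithin_le
    (C := ε * ‖w‖) (fun v _ => (hq v).hasFDerivWithinAt) (fun v hv => ?_)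
    (Metric.mem_closedBall_self (norm_nonneg w)) (y := w) (by simp)
  · simpa [pow_two, mul_assoc] using hmv
  · rw [mem_closedBall_zero_iff] at hv
    rw [mem_ball_zero_iff] at hw
    rw [innerSL_apply_norm]
    refine (hb v (by simpa using hv.trans_lt hw)).trans ?_
    gcongr

/-- Second-order expansion of a Legendre conjugate: if `ψ` is convex with a nondegenerate
second-order expansion at `z₀`, and `F` agrees near `x` with the conjugate of `ψ`, then `F` has a
second-order expansion at `x`, with the inverse Hessian. -/
theorem isLittleO_taylor_two_conjugate {ψ F : E → ℝ} {D : E ≃L[ℝ] E} {z₀ x : E} {c : ℝ}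
    (hψ : ConvexOn ℝ Set.univ ψ) (hsym : ∀ v w, ⟪D v, w⟫ = ⟪v, D w⟫) (hc : 0 < c)
    (hD : ∀ w, c * ‖w‖ ^ 2 ≤ ⟪D w, w⟫)
    (hexp : (fun w => ψ (z₀ + w) - ψ z₀ - ⟪x, w⟫ - 1 / 2 * ⟪D w, w⟫)
      =o[nhds 0] fun w => ‖w‖ ^ 2)
    (hle : ∀ᶠ y in nhds x, ∀ z, ⟪z, y⟫ - ψ z ≤ F y)
    (hex : ∀ᶠ y in nhds x, ∃ z, F y ≤ ⟪z, y⟫ - ψ z)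
    (hx : F x = ⟪z₀, x⟫ - ψ z₀) :
    (fun y => F y - F x - ⟪z₀, y - x⟫ - 1 / 2 * ⟪D.symm (y - x), y - x⟫)
      =o[nhds x] fun y => ‖y - x‖ ^ 2 := by
  rw [isLittleO_iff]
  intro ε' hε'
  set M : ℝ := ‖(D.symm : E →L[ℝ] E)‖ + 1 with hM
  have hM0 : 0 < M := by positivity
  have hMle : ∀ u, ‖D.symm u‖ ≤ M * ‖u‖ := fun u =>
    ((D.symm : E →L[ℝ] E).le_opNorm u).trans (by gcongr; simp [hM])
  obtain ⟨ε, hε, hεc, hεM⟩ : ∃ ε : ℝ, 0 < ε ∧ ε ≤ c / 8 ∧ 2 * ε * M ^ 2 ≤ ε' := by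
    refine ⟨min (c / 8) (ε' / (2 * M ^ 2)), by positivity, min_le_left _ _, ?_⟩
    have := (le_div_iff₀ (by positivity)).1 (min_le_right (c / 8) (ε' / (2 * M ^ 2)))
    linarith
  obtain ⟨δ', hδ', hb⟩ := Metric.eventually_nhds_iff_ball.1 (hexp.def hε)
  obtain ⟨δ, hδ, hδδ'⟩ := exists_between hδ'
  set G : E → ℝ := fun w => ψ (z₀ + w) - ψ z₀ - ⟪x, w⟫ with hG
  have hGb : ∀ w, ‖w‖ ≤ δ → |G w - 1 / 2 * ⟪D w, w⟫| ≤ ε * ‖w‖ ^ 2 := by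
    intro w hw
    simpa using hb w (by simpa using hw.trans_lt hδδ')
  have hη : 0 < min (δ / M) (c * δ / 4) := by positivity
  filter_upwards [hle, hex, Metric.closedBall_mem_nhds x hη] with y hley hexy hy
  rw [mem_closedBall_iff_norm, le_min_iff] at hy
  set u := y - x with hu
  obtain ⟨hy1, hy2⟩ := hy
  have hbase : ∀ w, ⟪z₀ + w, y⟫ - ψ (z₀ + w) - F x - ⟪z₀, u⟫ = ⟪w, u⟫ - G w := by
    intro w
    simp only [hG, hx, hu, inner_add_left, inner_sub_right, real_inner_comm w x]
    ring
  have hw0 : ‖D.symm u‖ ^ 2 ≤ M ^ 2 * ‖u‖ ^ 2 := by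
    rw [← mul_pow]
    exact pow_le_pow_left₀ (norm_nonneg _) (hMle u) 2
  have hεu : 2 * (ε * ‖D.symm u‖ ^ 2) ≤ ε' * ‖u‖ ^ 2 := by
    have h1 := mul_le_mul_of_nonneg_left hw0 hε.le
    have h2 := mul_le_mul_of_nonneg_right hεM (sq_nonneg ‖u‖)
    linarith
  have hεu0 : 0 ≤ ε * ‖D.symm u‖ ^ 2 := by positivity
  have hDu : D (D.symm u) = u := D.apply_symm_apply u
  rw [Real.norm_eq_abs, norm_pow, norm_norm, abs_le]
  constructor
  · have h1 := hbase (D.symm u)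
    have h2 := hley (z₀ + D.symm u)
    have h3 := (abs_le.1 (hGb (D.symm u) ((hMle u).trans
      (by rw [mul_comm]; exact (le_div_iff₀ hM0).1 hy1)))).2
    rw [hDu, real_inner_comm] at h3
    linarith
  · obtain ⟨z, hz⟩ := hexy
    obtain ⟨w, rfl⟩ : ∃ w, z = z₀ + w := ⟨z - z₀, by simp⟩
    have h1 := hbase w
    rcases le_or_gt ‖w‖ δ with hw | hw
    · have h2 := (abs_le.1 (hGb w hw)).1
      obtain ⟨v, rfl⟩ : ∃ v, w = D.symm u + v := ⟨w - D.symm u, by simp⟩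
      have h3 : ‖D.symm u + v‖ ^ 2 ≤ 2 * ‖D.symm u‖ ^ 2 + 2 * ‖v‖ ^ 2 := by
        have := norm_add_le (D.symm u) v
        nlinarith [norm_nonneg (D.symm u + v), sq_nonneg (‖D.symm u‖ - ‖v‖)]
      have h4 : ⟪D v, D.symm u⟫ = ⟪u, v⟫ := by rw [hsym, hDu, real_inner_comm]
      have h5 := hD v
      have h6 : ε * ‖D.symm u + v‖ ^ 2 ≤ 2 * (ε * ‖D.symm u‖ ^ 2) + c / 4 * ‖v‖ ^ 2 := by
        have := mul_le_mul_of_nonneg_left h3 hε.le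
        have := mul_le_mul_of_nonneg_right hεc (sq_nonneg ‖v‖)
        linarith
      rw [map_add, hDu, inner_add_right, inner_add_left, inner_add_left, h4,
        real_inner_comm (D.symm u) u] at h2
      have h7 : 0 ≤ c * ‖v‖ ^ 2 := by positivity
      have h8 : ⟪D.symm u + v, u⟫ = ⟪D.symm u, u⟫ + ⟪u, v⟫ := by
        rw [inner_add_left, real_inner_comm u v]
      linarith
    · have hwpos : 0 < ‖w‖ := hδ.trans hw
      set t := δ / ‖w‖ with ht
      have ht0 : 0 < t := by positivity
      have ht1 : t ≤ 1 := (div_le_one hwpos).2 hw.le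
      have htw : ‖t • w‖ = δ := by
        rw [norm_smul, Real.norm_of_nonneg ht0.le, ht, div_mul_cancel₀ _ hwpos.ne']
      have h2 : G (t • w) ≤ t * G w := by
        have h := hψ.2 (Set.mem_univ z₀) (Set.mem_univ (z₀ + w))
          (sub_nonneg.2 ht1) ht0.le (sub_add_cancel 1 t)
        have h' : (1 - t) • z₀ + t • (z₀ + w) = z₀ + t • w := by module
        rw [h', smul_eq_mul, smul_eq_mul] at h
        simp only [hG, inner_smul_right]
        linarith
      have h3 := (abs_le.1 (hGb (t • w) htw.le)).1
      have h4 := hD (t • w)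
      rw [htw] at h3 h4
      have h5 : ε * δ ^ 2 ≤ c / 8 * δ ^ 2 := by gcongr
      have h6 : t * ⟪w, u⟫ ≤ δ * (c * δ / 4) := by
        rw [← real_inner_smul_left]
        refine (real_inner_le_norm _ _).trans ?_
        rw [htw]
        gcongr
      have h7 : t * ⟪w, u⟫ ≤ t * G w := by
        have : 0 ≤ c * δ ^ 2 := by positivity
        linarith
      have h8 : ⟪w, u⟫ ≤ G w := le_of_mul_le_mul_left h7 ht0
      have h9 : 0 ≤ ⟪D.symm u, u⟫ := by
        have := hD (D.symm u)
        rw [hDu, real_inner_comm] at this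
        exact (by positivity : 0 ≤ c * ‖D.symm u‖ ^ 2).trans this
      linarith

/-- A Lipschitz self-map of a finite-dimensional space maps null sets to null sets. -/
theorem LipschitzWith.addHaar_image_eq_zero {E : Type*} [NormedAddCommGroup E] [NormedSpace ℝ E]
    [FiniteDimensional ℝ E] [MeasurableSpace E] [BorelSpace E] {μ : Measure E} [μ.IsAddHaarMeasure]
    {C : NNReal} {f : E → E} (hf : LipschitzWith C f) {s : Set E} (hs : μ s = 0) :
    μ (f '' s) = 0 := by
  have hH : Measure.hausdorffMeasure (Module.finrank ℝ E : ℝ) s = 0 := by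
    rw [Measure.isAddLeftInvariant_eq_smul
      (Measure.hausdorffMeasure (Module.finrank ℝ E : ℝ)) μ]
    simp [hs]
  have hH' : Measure.hausdorffMeasure (Module.finrank ℝ E : ℝ) (f '' s) = 0 := by
    have := hf.hausdorffMeasure_image_le (Nat.cast_nonneg (Module.finrank ℝ E)) s
    simpa [hH] using this
  rw [Measure.isAddLeftInvariant_eq_smul μ
    (Measure.hausdorffMeasure (Module.finrank ℝ E : ℝ))]
  simp [hH']

/-- Almost every point in the range of a Lipschitz self-map is the image of a point at which the
map is differentiable with invertible derivative. -/
theorem LipschitzWith.addHaar_range_diff_regular_values_eq_zero {E : Type*}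
    [NormedAddCommGroup E] [NormedSpace ℝ E] [FiniteDimensional ℝ E] [MeasurableSpace E]
    [BorelSpace E] (μ : Measure E) [μ.IsAddHaarMeasure] {C : NNReal} {f : E → E}
    (hf : LipschitzWith C f) :
    μ (Set.range f \ {x | ∃ z, f z = x ∧ ∃ D : E ≃L[ℝ] E, HasFDerivAt f (D : E →L[ℝ] E) z}) = 0 := by
  have h1 : μ (f '' {z | ¬ DifferentiableAt ℝ f z}) = 0 :=
    hf.addHaar_image_eq_zero (ae_iff.1 hf.ae_differentiableAt)
  have h2 : μ (f '' {z | DifferentiableAt ℝ f z ∧ (fderiv ℝ f z).det = 0}) = 0 :=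
    addHaar_image_eq_zero_of_det_fderivWithin_eq_zero μ
      (fun z hz => hz.1.hasFDerivAt.hasFDerivWithinAt) fun z hz => hz.2
  refine measure_mono_null ?_ (measure_union_null h1 h2)
  rintro _ ⟨⟨z, rfl⟩, hz⟩
  by_cases hd : DifferentiableAt ℝ f z
  · refine Or.inr ⟨z, ⟨hd, ?_⟩, rfl⟩
    by_contra hdet
    refine hz ⟨z, rfl, (fderiv ℝ f z).toContinuousLinearEquivOfDetNeZero hdet, ?_⟩
    rw [ContinuousLinearMap.coe_toContinuousLinearEquivOfDetNeZero]
    exact hd.hasFDerivAt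
  · exact Or.inl ⟨z, hd, rfl⟩

/-- A derivative of a firmly nonexpansive map is firmly nonexpansive. -/
theorem norm_sq_le_inner_of_hasFDerivAt {J : E → E} {D : E →L[ℝ] E} {z₀ : E}
    (hJ : ∀ z w, ‖J z - J w‖ ^ 2 ≤ ⟪z - w, J z - J w⟫) (hD : HasFDerivAt J D z₀) (w : E) :
    ‖D w‖ ^ 2 ≤ ⟪D w, w⟫ := by
  have hlim := (hD.hasLineDerivAt w).tendsto_slope_zero
  refine le_of_tendsto_of_tendsto (hlim.norm.pow 2) (hlim.inner tendsto_const_nhds) ?_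
  filter_upwards [self_mem_nhdsWithin] with t ht
  have h1 := hJ (z₀ + t • w) z₀
  rw [add_sub_cancel_left, real_inner_comm, inner_smul_right] at h1
  have h2 : 0 ≤ t⁻¹ ^ 2 := sq_nonneg _
  have ht' : t ≠ 0 := ht
  rw [norm_smul, mul_pow, Real.norm_eq_abs, sq_abs, real_inner_smul_left]
  refine (mul_le_mul_of_nonneg_left h1 h2).trans_eq ?_
  field_simp

/-- At the proximal point `J z₀`, if the proximal map `J` is differentiable at `z₀` with invertible
derivative `D`, then `h` has a second-order expansion with gradient `z₀ - J z₀` and Hessian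
`D⁻¹ - 1`. -/
theorem isLittleO_taylor_two_of_prox {K : Set E} {h : E → ℝ} {J : E → E}
    (hJK : ∀ z, J z ∈ K) (hJ : ∀ z, ∀ y ∈ K, h (J z) + ⟪z - J z, y - J z⟫ ≤ h y)
    (hsub : ∀ y ∈ interior K, ∃ z, J z = y) {z₀ : E} (hz₀ : J z₀ ∈ interior K)
    {D : E ≃L[ℝ] E} (hD : HasFDerivAt J (D : E →L[ℝ] E) z₀) :
    (∀ v w, ⟪D v, w⟫ = ⟪v, D w⟫) ∧
      (fun y => h y - h (J z₀) - ⟪z₀ - J z₀, y - J z₀⟫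
        - 1 / 2 * ⟪D.symm (y - J z₀) - (y - J z₀), y - J z₀⟫)
        =o[nhds (J z₀)] fun y => ‖y - J z₀‖ ^ 2 := by
  have hfirm : ∀ z w, ‖J z - J w‖ ^ 2 ≤ ⟪z - w, J z - J w⟫ := fun z w =>
    norm_sub_sq_le_inner_of_prox (hJ z _ (hJK w)) (hJ w _ (hJK z))
  set ψ : E → ℝ := fun z => ⟪z, J z⟫ - (h (J z) + 1 / 2 * ‖J z‖ ^ 2) with hψ
  have hle : ∀ y ∈ K, ∀ z, ⟪z, y⟫ - ψ z ≤ h y + 1 / 2 * ‖y‖ ^ 2 := by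
    intro y hy z
    have h1 := hJ z y hy
    have h2 := sq_nonneg ‖y - J z‖
    rw [norm_sub_sq_real] at h2
    simp only [inner_sub_left, inner_sub_right, real_inner_self_eq_norm_sq] at h1
    rw [real_inner_comm] at h2
    simp only [hψ]
    linarith
  have heq : ∀ z, h (J z) + 1 / 2 * ‖J z‖ ^ 2 = ⟪z, J z⟫ - ψ z := fun z => by simp [hψ]
  have hψsub : ∀ z w, ψ z + ⟪J z, w - z⟫ ≤ ψ w := by
    intro z w
    have h1 := hle (J z) (hJK z) w
    rw [heq] at h1
    rw [inner_sub_right, real_inner_comm w, real_inner_comm z]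
    linarith
  have hgrad := hasFDerivAt_of_lipschitz_subgradient
    (lipschitzWith_of_firmly_nonexpansive hfirm) hψsub
  have hsym := inner_symm_of_hasFDerivAt_gradient hgrad hD
  refine ⟨hsym, ?_⟩
  set M : ℝ := ‖(D.symm : E →L[ℝ] E)‖ + 1 with hM
  have hM0 : 0 < M := by positivity
  have hcoer : ∀ w, (M ^ 2)⁻¹ * ‖w‖ ^ 2 ≤ ⟪D w, w⟫ := by
    intro w
    refine le_trans ?_ (norm_sq_le_inner_of_hasFDerivAt hfirm hD w)
    rw [inv_mul_le_iff₀ (by positivity), ← mul_pow]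
    refine pow_le_pow_left₀ (norm_nonneg _) ?_ 2
    have := (D.symm : E →L[ℝ] E).le_opNorm (D w)
    rw [ContinuousLinearEquiv.coe_coe, D.symm_apply_apply] at this
    refine this.trans ?_
    rw [ContinuousLinearEquiv.coe_coe]
    gcongr
    simp [hM]
  have hmem : ∀ᶠ y in nhds (J z₀), y ∈ interior K := isOpen_interior.mem_nhds hz₀
  have hmain := isLittleO_taylor_two_conjugate (F := fun y => h y + 1 / 2 * ‖y‖ ^ 2)
    (convexOn_of_subgradient hψsub) hsym (by positivity : 0 < (M ^ 2)⁻¹) hcoer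
    (isLittleO_taylor_two_of_hasFDerivAt_gradient hgrad hD)
    (hmem.mono fun y hy => hle y (interior_subset hy))
    (hmem.mono fun y hy => by
      obtain ⟨z, rfl⟩ := hsub y hy
      exact ⟨z, (heq z).le⟩)
    (heq z₀)
  refine hmain.congr_left fun y => ?_
  simp only [inner_sub_left, inner_sub_right, real_inner_self_eq_norm_sq]
  rw [real_inner_comm (J z₀) y]
  ring

/-- A subgradient inequality on `K` at `x` exhibits `x` as a proximal point. -/
theorem prox_eq_of_subgradient {K : Set E} {h : E → ℝ} {J : E → E}
    (hJK : ∀ z, J z ∈ K) (hJ : ∀ z, ∀ y ∈ K, h (J z) + ⟪z - J z, y - J z⟫ ≤ h y) {x p : E}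
    (hx : x ∈ K) (hp : ∀ y ∈ K, h x + ⟪p, y - x⟫ ≤ h y) : J (x + p) = x := by
  have h1 := norm_sub_sq_le_inner_of_prox (w := x + p) (hJ (x + p) x hx)
    (by simpa using hp _ (hJK (x + p)))
  rw [sub_self, inner_zero_left] at h1
  simpa [sub_eq_zero] using le_antisymm h1 (sq_nonneg _)

end AlexandrovAux

theorem volume_ball_diff_alexandrov_eq_zero {m : ℕ} {r R : ℝ} (hr : 0 < r) (hrR : r < R)
    {h : EuclideanSpace ℝ (Fin m) → ℝ}
    (hconv : ConvexOn ℝ (Metric.ball (0 : EuclideanSpace ℝ (Fin m)) R) h) :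
    volume (Metric.ball (0 : EuclideanSpace ℝ (Fin m)) r \
      {x | ∃ (g : EuclideanSpace ℝ (Fin m))
        (A : EuclideanSpace ℝ (Fin m) →L[ℝ] EuclideanSpace ℝ (Fin m)),
        (∀ v w, ⟪A v, w⟫ = ⟪v, A w⟫) ∧ Alexandrov2 h x g A}) = 0 := by
  have hcont := hconv.continuousOn Metric.isOpen_ball
  have hsubset : Metric.closedBall (0 : EuclideanSpace ℝ (Fin m)) r ⊆ Metric.ball 0 R :=
    Metric.closedBall_subset_ball hrR
  choose J hJK hJ using (hconv.subset hsubset (convex_closedBall _ _)).exists_prox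
    (isCompact_closedBall _ _) (Metric.nonempty_closedBall.2 hr.le) (hcont.mono hsubset)
  have hsurj : ∀ x ∈ Metric.closedBall (0 : EuclideanSpace ℝ (Fin m)) r, ∃ z, J z = x := by
    intro x hx
    obtain ⟨p, hp⟩ := hconv.exists_subgradient Metric.isOpen_ball hcont (hsubset hx)
    exact ⟨x + p, prox_eq_of_subgradient hJK hJ hx fun y hy => hp y (hsubset hy)⟩
  have hlip : LipschitzWith 1 J := lipschitzWith_of_firmly_nonexpansive fun z w =>
    norm_sub_sq_le_inner_of_prox (hJ z _ (hJK w)) (hJ w _ (hJK z))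
  refine measure_mono_null ?_ (hlip.addHaar_range_diff_regular_values_eq_zero volume)
  rintro x ⟨hx, hnot⟩
  refine ⟨hsurj x (Metric.ball_subset_closedBall hx), ?_⟩
  rintro ⟨z, rfl, D, hD⟩
  obtain ⟨hsym, hexp⟩ := isLittleO_taylor_two_of_prox hJK hJ
    (fun y hy => hsurj y (interior_subset hy))
    (interior_mono Metric.ball_subset_closedBall (by rwa [Metric.isOpen_ball.interior_eq])) hD
  refine hnot ⟨z - J z, (D.symm : _ →L[ℝ] _) - ContinuousLinearMap.id ℝ _, fun v w => ?_, ?_⟩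
  · have := hsym (D.symm v) (D.symm w)
    simp only [D.apply_symm_apply] at this
    simp [inner_sub_left, inner_sub_right, this]
  · exact hexp

/-- Busemann–Feller–Alexandrov theorem: a convex function on a ball `B_R ⊆ ℝ^m` is twice
Alexandrov differentiable (with a symmetric Hessian) at Lebesgue-almost every point of `B_R`. -/
theorem convex_ae_alexandrov_twice_differentiable {m : ℕ} (R : ℝ) (hR : 0 < R)
    (h : EuclideanSpace ℝ (Fin m) → ℝ)
    (hconv : ConvexOn ℝ (Metric.ball (0 : EuclideanSpace ℝ (Fin m)) R) h) :
    volume (Metric.ball (0 : EuclideanSpace ℝ (Fin m)) R \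
      {x | ∃ (g : EuclideanSpace ℝ (Fin m))
        (A : EuclideanSpace ℝ (Fin m) →L[ℝ] EuclideanSpace ℝ (Fin m)),
        (∀ v w, ⟪A v, w⟫ = ⟪v, A w⟫) ∧ Alexandrov2 h x g A}) = 0 := by
  obtain ⟨u, -, hu, hlim⟩ := exists_seq_strictMono_tendsto' hR
  refine measure_mono_null ?_ (measure_iUnion_null fun n =>
    volume_ball_diff_alexandrov_eq_zero (hu n).1 (hu n).2 hconv)
  rintro x ⟨hx, hnot⟩
  obtain ⟨n, hn⟩ := (hlim.eventually_const_lt (mem_ball_zero_iff.1 hx)).exists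
  exact Set.mem_iUnion.2 ⟨n, mem_ball_zero_iff.2 hn, hnot⟩
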